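/- (Existence of a stationary state for a positive trace-preserving map.) Let n be a nonempty finite type and let Φ : Matrix n n ℂ → Matrix n n ℂ be a linear map such that Φ sends positive semidefinite matrices to positive semidefinite matrices and preserves the trace: (Φ M).trace = M.trace for all M. Then there exists a density matrix fixed by Φ, i.e. a matrix ρ : Matrix n n ℂ with ρ positive semidefinite, trace ρ = 1, and Φ ρ = ρ. -/

import Mathlib

open scoped ComplexOrder

/-- The Markov–Kakutani fixed point theorem for a single continuous linear map. -/
theorem ContinuousLinearMap.exists_fixed_mem_of_mapsTo {E : Type*} [NormedAddCommGroup E]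
    [NormedSpace ℝ E] (T : E →L[ℝ] E) {K : Set E} (hK : IsCompact K) (hconv : Convex ℝ K)
    (hne : K.Nonempty) (hT : Set.MapsTo T K K) : ∃ x ∈ K, T x = x := by
  obtain ⟨x, hx⟩ := hne
  have horbit (k : ℕ) : T^[k] x ∈ K := hT.iterate k hx
  have hmem (n : ℕ) : birkhoffAverage ℝ T id (n + 1) x ∈ K := by
    rw [birkhoffAverage, birkhoffSum, Finset.smul_sum]
    refine hconv.sum_mem (fun _ _ ↦ by positivity) ?_ fun k _ ↦ horbit k
    rw [Finset.sum_const, Finset.card_range, nsmul_eq_mul]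
    exact mul_inv_cancel₀ (by positivity)
  have hcomm (n : ℕ) : birkhoffAverage ℝ T id n (T x) = T (birkhoffAverage ℝ T id n x) := by
    simp only [birkhoffAverage, birkhoffSum, id, map_smul, map_sum,
      ← Function.iterate_succ_apply, Function.iterate_succ_apply']
  obtain ⟨y, hy, φ, hφ, hlim⟩ := hK.tendsto_subseq hmem
  refine ⟨y, hy, sub_eq_zero.mp ?_⟩
  have hzero := (tendsto_birkhoffAverage_apply_sub_birkhoffAverage ℝ (f := T) (g := id) (x := x)
    (hK.isBounded.subset (Set.range_subset_iff.mpr horbit))).comp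
      ((Filter.tendsto_add_atTop_nat 1).comp hφ.tendsto_atTop)
  refine tendsto_nhds_unique (((T.continuous.tendsto y).comp hlim).sub hlim) (hzero.congr fun n ↦ ?_)
  simp [hcomm]

section DensityMatrix

open scoped Matrix.Norms.Frobenius

variable {n : Type*} [Fintype n]

theorem Matrix.re_trace_conjTranspose_mul_self_eq_frobenius_norm_sq (B : Matrix n n ℂ) :
    (B.conjTranspose * B).trace.re = ‖B‖ ^ 2 := by
  rw [Matrix.frobenius_norm_def, ← Real.sqrt_eq_rpow, Real.sq_sqrt (by positivity),
    Finset.sum_comm]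
  simp [Matrix.trace, Matrix.mul_apply, ← Complex.normSq_eq_norm_sq, Complex.normSq_apply]

theorem Matrix.PosSemidef.frobenius_norm_le_re_trace {M : Matrix n n ℂ}
    (hM : M.PosSemidef) : ‖M‖ ≤ M.trace.re := by
  classical
  open scoped MatrixOrder in
  obtain ⟨B, rfl⟩ := CStarAlgebra.nonneg_iff_eq_star_mul_self.mp hM.nonneg
  rw [Matrix.star_eq_conjTranspose, Matrix.re_trace_conjTranspose_mul_self_eq_frobenius_norm_sq,
    sq]
  exact (Matrix.frobenius_norm_mul _ _).trans_eq (by rw [Matrix.frobenius_norm_conjTranspose])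

theorem Matrix.isClosed_setOf_posSemidef : IsClosed {M : Matrix n n ℂ | M.PosSemidef} := by
  simp only [Matrix.posSemidef_iff_dotProduct_mulVec, Set.ofPred_and, Set.ofPred_forall]
  refine (isClosed_eq (by fun_prop) continuous_id).inter (isClosed_iInter fun x ↦ ?_)
  exact isClosed_le continuous_const (by fun_prop)

theorem Matrix.isCompact_setOf_posSemidef_trace_eq_one :
    IsCompact {M : Matrix n n ℂ | M.PosSemidef ∧ M.trace = 1} := by
  have : ProperSpace (Matrix n n ℂ) := FiniteDimensional.proper ℂ _
  refine Metric.isCompact_of_isClosed_isBounded ?_ ?_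
  · exact Matrix.isClosed_setOf_posSemidef.inter (isClosed_eq (by fun_prop) continuous_const)
  · refine isBounded_iff_forall_norm_le.mpr ⟨1, fun M hM ↦ ?_⟩
    simpa [hM.2] using hM.1.frobenius_norm_le_re_trace

theorem Matrix.convex_setOf_posSemidef_trace_eq_one :
    Convex ℝ {M : Matrix n n ℂ | M.PosSemidef ∧ M.trace = 1} := by
  rintro A ⟨hA, hA'⟩ B ⟨hB, hB'⟩ a b ha hb hab
  refine ⟨(hA.smul ha).add (hB.smul hb), ?_⟩
  rw [Matrix.trace_add, Matrix.trace_smul, Matrix.trace_smul, hA', hB', ← add_smul, hab, one_smul]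

theorem Matrix.nonempty_setOf_posSemidef_trace_eq_one [Nonempty n] :
    {M : Matrix n n ℂ | M.PosSemidef ∧ M.trace = 1}.Nonempty := by
  classical
  obtain ⟨i⟩ := ‹Nonempty n›
  refine ⟨Matrix.diagonal (Pi.single i 1), Matrix.PosSemidef.diagonal ?_, ?_⟩
  · exact Pi.single_nonneg.mpr zero_le_one
  · simp [Matrix.trace_diagonal]

theorem Matrix.exists_posSemidef_trace_eq_one_fixed [Nonempty n]
    (Φ : Matrix n n ℂ →ₗ[ℂ] Matrix n n ℂ)
    (hpos : ∀ M : Matrix n n ℂ, M.PosSemidef → (Φ M).PosSemidef)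
    (htrace : ∀ M : Matrix n n ℂ, (Φ M).trace = M.trace) :
    ∃ ρ : Matrix n n ℂ, ρ.PosSemidef ∧ ρ.trace = 1 ∧ Φ ρ = ρ := by
  obtain ⟨ρ, ⟨hρ, hρ'⟩, hfix⟩ :=
    ((LinearMap.toContinuousLinearMap Φ).restrictScalars ℝ).exists_fixed_mem_of_mapsTo
      Matrix.isCompact_setOf_posSemidef_trace_eq_one Matrix.convex_setOf_posSemidef_trace_eq_one
      Matrix.nonempty_setOf_posSemidef_trace_eq_one
      fun M hM ↦ ⟨hpos M hM.1, (htrace M).trans hM.2⟩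
  exact ⟨ρ, hρ, hρ', hfix⟩

end DensityMatrix

/-- A positive trace-preserving linear map on complex matrices has a fixed
density matrix: there exists `ρ` positive semidefinite with trace `1` and `Φ ρ = ρ`. -/
theorem exists_stationary_density_matrix
    {n : Type*} [Fintype n] [DecidableEq n] [Nonempty n]
    (Φ : Matrix n n ℂ →ₗ[ℂ] Matrix n n ℂ)
    (hpos : ∀ M : Matrix n n ℂ, M.PosSemidef → (Φ M).PosSemidef)
    (htrace : ∀ M : Matrix n n ℂ, (Φ M).trace = M.trace) :
    ∃ ρ : Matrix n n ℂ, ρ.PosSemidef ∧ ρ.trace = 1 ∧ Φ ρ = ρ :=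
  Matrix.exists_posSemidef_trace_eq_one_fixed Φ hpos htrace
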